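/- Let 1 ≤ p < ∞, 0 < q, r < ∞, let u, v, w be weights on (a,b), and let {x_k}_{k=N}^∞ with N ∈ ℤ be a discretizing sequence of W*(t) = ∫_t^b w. Then the inequality (Σ_{k=N+1}^∞ 2^{-k} (∫_{x_k}^{x_{k+1}} u)^{r/q} (Σ_{j=N+1}^k a_j V_p(x_{j-1}, x_j))^r)^{1/r} ≤ C'' (Σ_{k=N+1}^∞ a_k^p)^{1/p} holds for every sequence of non-negative numbers {a_k}_{k=N+1}^∞ if and only if: (i) in the case p ≤ r, ℬ₁ := sup_{N+1 ≤ k < ∞} (Σ_{i=k}^∞ 2^{-i} (∫_{x_i}^{x_{i+1}} u)^{r/q})^{1/r} V_p(a, x_k) < ∞, and then the best constant satisfies C'' ≈ ℬ₁; (ii) in the case r < p, ℬ₂ := (Σ_{k=N+1}^∞ 2^{-k} (∫_{x_k}^{x_{k+1}} u)^{r/q} (Σ_{i=k}^∞ 2^{-i} (∫_{x_i}^{x_{i+1}} u)^{r/q})^{r/(p-r)} V_p(a, x_k)^{pr/(p-r)})^{(p-r)/(pr)} < ∞, and then the best constant satisfies C'' ≈ ℬ₂. -/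

import Mathlib

open MeasureTheory Set ENNReal NNReal

noncomputable section

/-- The open interval `(a, b)` with extended-real endpoints, viewed as a set of reals. -/
def io (a b : EReal) : Set ℝ := {x : ℝ | a < (x : EReal) ∧ (x : EReal) < b}

/-- A weight on `(a, b)`: a measurable function which is positive and finite on `(a, b)`. -/
def IsWeight (a b : EReal) (u : ℝ → ℝ≥0∞) : Prop :=
  Measurable u ∧ ∀ x ∈ io a b, 0 < u x ∧ u x < ⊤

/-- `W*(t) = ∫_t^b w`. -/
def Wstar (b : EReal) (w : ℝ → ℝ≥0∞) (t : ℝ) : ℝ≥0∞ := ∫⁻ s in io t b, w s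

/-- `{x_k}_{k=N}^∞ ⊂ [a, b]` is a discretizing sequence of `W*` with constants
`d₁, d₂`: it is strictly increasing, starts at `a`, and `W*(x_k) ≈ 2 ^ (-k)`. -/
def IsDiscretizing (a b : EReal) (w : ℝ → ℝ≥0∞) (N : ℤ) (x : ℤ → ℝ)
    (d₁ d₂ : ℝ≥0∞) : Prop :=
  (x N : EReal) = a ∧
  (∀ k : ℤ, N ≤ k → x k < x (k + 1)) ∧
  (∀ k : ℤ, N ≤ k → a ≤ (x k : EReal) ∧ (x k : EReal) ≤ b) ∧
  ∀ k : ℤ, N ≤ k →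
    d₁ * (2 : ℝ≥0∞) ^ (-(k : ℝ)) ≤ Wstar b w (x k) ∧
    Wstar b w (x k) ≤ d₂ * (2 : ℝ≥0∞) ^ (-(k : ℝ))

/-- `V_p(x, y)` from the paper. -/
def Vp (p : ℝ) (v : ℝ → ℝ≥0∞) (x y : EReal) : ℝ≥0∞ :=
  if p = 1 then essSup (fun s => (v s)⁻¹) (volume.restrict (io x y))
  else (∫⁻ s in io x y, v s ^ (-(1 / (p - 1)))) ^ ((p - 1) / p)

/-- The left-hand side of the discrete inequality `(3.6)`. -/
def lhsSeq (N : ℤ) (x : ℤ → ℝ) (p q r : ℝ) (u v : ℝ → ℝ≥0∞) (aseq : ℕ → ℝ≥0) : ℝ≥0∞ :=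
  (∑' k : ℕ, (2 : ℝ≥0∞) ^ (-((N + 1 + k : ℤ) : ℝ)) *
    (∫⁻ t in Ioo (x (N + 1 + k)) (x (N + 2 + k)), u t) ^ (r / q) *
    (∑ j ∈ Finset.range (k + 1),
      (aseq j : ℝ≥0∞) * Vp p v (x (N + j)) (x (N + 1 + j))) ^ r) ^ (1 / r)

/-- The best constant in the discrete inequality `(3.6)`. -/
def bestSeq (N : ℤ) (x : ℤ → ℝ) (p q r : ℝ) (u v : ℝ → ℝ≥0∞) : ℝ≥0∞ :=
  sInf {C : ℝ≥0∞ | ∀ aseq : ℕ → ℝ≥0,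
    lhsSeq N x p q r u v aseq ≤ C * (∑' k : ℕ, (aseq k : ℝ≥0∞) ^ p) ^ (1 / p)}

/-- The constant `ℬ₁`. -/
def B1 (a : EReal) (N : ℤ) (x : ℤ → ℝ) (p q r : ℝ) (u v : ℝ → ℝ≥0∞) : ℝ≥0∞ :=
  ⨆ k : ℕ,
    (∑' i : ℕ, (2 : ℝ≥0∞) ^ (-((N + 1 + k + i : ℤ) : ℝ)) *
        (∫⁻ t in Ioo (x (N + 1 + k + i)) (x (N + 2 + k + i)), u t) ^ (r / q)) ^ (1 / r) *
      Vp p v a (x (N + 1 + k))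

/-- The constant `ℬ₂`. -/
def B2 (a : EReal) (N : ℤ) (x : ℤ → ℝ) (p q r : ℝ) (u v : ℝ → ℝ≥0∞) : ℝ≥0∞ :=
  (∑' k : ℕ, (2 : ℝ≥0∞) ^ (-((N + 1 + k : ℤ) : ℝ)) *
    (∫⁻ t in Ioo (x (N + 1 + k)) (x (N + 2 + k)), u t) ^ (r / q) *
    (∑' i : ℕ, (2 : ℝ≥0∞) ^ (-((N + 1 + k + i : ℤ) : ℝ)) *
        (∫⁻ t in Ioo (x (N + 1 + k + i)) (x (N + 2 + k + i)), u t) ^ (r / q)) ^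
      (r / (p - r)) *
    Vp p v a (x (N + 1 + k)) ^ (p * r / (p - r))) ^ ((p - r) / (p * r))

/-- The last index up to `n` at which `T` more than doubled its previously recorded value. -/
def mark (T : ℕ → ℝ≥0∞) : ℕ → ℕ
  | 0 => 0
  | n + 1 => open Classical in if 2 * T (mark T n) < T (n + 1) then n + 1 else mark T n

lemma mark_succ_of_lt {T : ℕ → ℝ≥0∞} {n : ℕ} (h : 2 * T (mark T n) < T (n + 1)) :
    mark T (n + 1) = n + 1 := by
  simp [mark, h]

lemma mark_succ_of_not_lt {T : ℕ → ℝ≥0∞} {n : ℕ} (h : ¬ 2 * T (mark T n) < T (n + 1)) :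
    mark T (n + 1) = mark T n := by
  simp only [mark, if_neg h]

lemma mark_le (T : ℕ → ℝ≥0∞) (n : ℕ) : mark T n ≤ n := by
  induction n with
  | zero => simp [mark]
  | succ n ih =>
    by_cases h : 2 * T (mark T n) < T (n + 1)
    · rw [mark_succ_of_lt h]
    · rw [mark_succ_of_not_lt h]; omega

lemma le_two_mul_mark (T : ℕ → ℝ≥0∞) (n : ℕ) : T n ≤ 2 * T (mark T n) := by
  have key (x : ℝ≥0∞) : x ≤ 2 * x := by rw [two_mul]; exact le_self_add
  cases n with
  | zero => exact key _
  | succ n =>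
    by_cases h : 2 * T (mark T n) < T (n + 1)
    · rw [mark_succ_of_lt h]; exact key _
    · rw [mark_succ_of_not_lt h]; exact not_lt.1 h

lemma of_mark_succ_eq {T : ℕ → ℝ≥0∞} {k n : ℕ} (h : mark T (k + 1) = n + 1) :
    n ≤ k ∧ 2 * T (mark T n) < T (n + 1) := by
  induction k with
  | zero =>
    by_cases h' : 2 * T (mark T 0) < T (0 + 1)
    · rw [mark_succ_of_lt h'] at h
      obtain rfl : n = 0 := by omega
      exact ⟨le_rfl, h'⟩
    · rw [mark_succ_of_not_lt h'] at h
      simp [mark] at h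
  | succ k ih =>
    by_cases h' : 2 * T (mark T (k + 1)) < T (k + 1 + 1)
    · rw [mark_succ_of_lt h'] at h
      obtain rfl : n = k + 1 := by omega
      exact ⟨le_rfl, h'⟩
    · rw [mark_succ_of_not_lt h'] at h
      exact ⟨(ih h).1.trans (Nat.le_succ k), (ih h).2⟩

open Classical in
lemma sum_blocks (T f : ℕ → ℝ≥0∞) (K : ℕ) :
    ∑ n ∈ Finset.range K, (if 2 * T (mark T n) < T (n + 1) then
      ∑ j ∈ Finset.Ico (mark T n) (n + 1), f j else 0) = ∑ j ∈ Finset.range (mark T K), f j := by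
  induction K with
  | zero => simp [mark]
  | succ K ih =>
    rw [Finset.sum_range_succ, ih]
    by_cases h : 2 * T (mark T K) < T (K + 1)
    · rw [mark_succ_of_lt h, if_pos h]
      exact Finset.sum_range_add_sum_Ico _ ((mark_le T K).trans (Nat.le_succ K))
    · rw [mark_succ_of_not_lt h, if_neg h, add_zero]

open Classical in
lemma tsum_blocks_le (T f : ℕ → ℝ≥0∞) :
    ∑' n, (if 2 * T (mark T n) < T (n + 1) then
      ∑ j ∈ Finset.Ico (mark T n) (n + 1), f j else 0) ≤ ∑' j, f j := by
  rw [ENNReal.tsum_eq_iSup_nat]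
  refine iSup_le fun K => ?_
  rw [sum_blocks]
  exact ENNReal.sum_le_tsum _

open Classical in
lemma tsum_mul_comp_mark (T α g : ℕ → ℝ≥0∞) (h0 : g 0 = 0) :
    ∑' k, α k * g (mark T (k + 1)) =
      ∑' n, (∑' k, if mark T (k + 1) = n + 1 then α k else 0) * g (n + 1) := by
  simp_rw [← ENNReal.tsum_mul_right]
  rw [ENNReal.tsum_comm]
  refine tsum_congr fun k => ?_
  cases hk : mark T (k + 1) with
  | zero => simp [h0]
  | succ m =>
    rw [tsum_eq_single m]
    · simp
    · intro n hn
      rw [if_neg (by omega), zero_mul]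

open Classical in
lemma sum_marked_rpow_le {T : ℕ → ℝ≥0∞} {σ : ℝ} (hσ : 0 < σ) {g : ℝ≥0∞}
    (hg : g * 2⁻¹ ^ σ + 1 ≤ g) (K : ℕ) :
    ∑ n ∈ Finset.range K, (if 2 * T (mark T n) < T (n + 1) then T (n + 1) ^ σ else 0)
      ≤ g * T (mark T K) ^ σ := by
  induction K with
  | zero => simp
  | succ K ih =>
    rw [Finset.sum_range_succ]
    by_cases h : 2 * T (mark T K) < T (K + 1)
    · rw [mark_succ_of_lt h, if_pos h]
      have h1 : T (mark T K) ≤ 2⁻¹ * T (K + 1) := by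
        rw [← ENNReal.inv_mul_cancel_left (a := 2) (b := T (mark T K)) (by simp) (by simp)]
        gcongr
      calc _ ≤ g * (2⁻¹ * T (K + 1)) ^ σ + T (K + 1) ^ σ := by
            gcongr; exact ih.trans (by gcongr)
        _ = (g * 2⁻¹ ^ σ + 1) * T (K + 1) ^ σ := by
            rw [ENNReal.mul_rpow_of_nonneg _ _ hσ.le]; ring
        _ ≤ _ := by gcongr
    · rw [mark_succ_of_not_lt h, if_neg h, add_zero]; exact ih

lemma tsum_shift_eq (c : ℕ → ℝ≥0∞) (n : ℕ) :
    ∑' i, c (n + i) = ∑' k, if n ≤ k then c k else 0 := by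
  have h := Summable.sum_add_tsum_nat_add' (f := fun k => if n ≤ k then c k else 0) (k := n)
    ENNReal.summable
  rw [← h, Finset.sum_eq_zero, zero_add]
  · refine tsum_congr fun i => ?_
    rw [if_pos (by omega), add_comm]
  · intro i hi
    rw [if_neg (by simpa using hi)]

lemma add_rpow_le {s : ℝ} (hs : 1 ≤ s) (x y : ℝ≥0∞) :
    (x + y) ^ s ≤ y ^ s + ENNReal.ofReal s * x * (x + y) ^ (s - 1) := by
  have hs0 : 0 < s := by linarith
  rcases eq_or_ne y ⊤ with rfl | hy
  · simp [hs0]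
  rcases eq_or_ne x ⊤ with rfl | hx
  · have : (⊤ : ℝ≥0∞) ^ (s - 1) ≠ 0 := by
      rcases hs.eq_or_lt with rfl | h
      · simp
      · simp [ENNReal.top_rpow_of_pos (sub_pos.2 h)]
    rw [top_add, ENNReal.mul_top (by simpa using hs0), ENNReal.top_mul this]
    simp
  lift x to ℝ≥0 using hx
  lift y to ℝ≥0 using hy
  rcases eq_or_ne (x + y) 0 with h0 | h0
  · obtain ⟨rfl, rfl⟩ : x = 0 ∧ y = 0 := by simpa using h0
    simp [hs0]
  rw [← ENNReal.coe_add, ← ENNReal.coe_rpow_of_nonneg _ hs0.le,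
    ← ENNReal.coe_rpow_of_nonneg _ hs0.le, ← ENNReal.coe_rpow_of_nonneg _ (sub_nonneg.2 hs),
    ENNReal.ofReal]
  norm_cast
  rw [← NNReal.coe_le_coe]
  push_cast
  rw [Real.coe_toNNReal _ hs0.le]
  have hz : (0 : ℝ) < x + y := by
    have := pos_iff_ne_zero.2 h0
    exact_mod_cast this
  have hx0 : (0 : ℝ) ≤ x := x.2
  have hy0 : (0 : ℝ) ≤ y := y.2
  generalize (x : ℝ) = x at *
  generalize (y : ℝ) = y at *
  have hb := one_add_mul_self_le_rpow_one_add (s := y / (x + y) - 1)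
    (by have : 0 ≤ y / (x + y) := by positivity
        linarith) hs
  rw [add_sub_cancel, Real.div_rpow hy0 hz.le] at hb
  have hzs : 0 < (x + y) ^ s := Real.rpow_pos_of_pos hz s
  rw [le_div_iff₀ hzs] at hb
  have e : (x + y) ^ s = (x + y) ^ (s - 1) * (x + y) := by
    rw [← Real.rpow_add_one hz.ne']; ring_nf
  have : (1 + s * (y / (x + y) - 1)) * (x + y) ^ s
      = (x + y) ^ s - s * x * (x + y) ^ (s - 1) := by
    rw [e]; field_simp; ring
  linarith

lemma sum_rpow_le_tail {s : ℝ} (hs : 1 ≤ s) (n : ℕ) (c : ℕ → ℝ≥0∞) :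
    (∑ k ∈ Finset.range n, c k) ^ s ≤
      ENNReal.ofReal s * ∑ k ∈ Finset.range n, c k * (∑' i, c (k + i)) ^ (s - 1) := by
  induction n generalizing c with
  | zero => simp [show 0 < s by linarith]
  | succ n ih =>
    rw [Finset.sum_range_succ', Finset.sum_range_succ', add_comm, mul_add]
    refine (add_rpow_le hs _ _).trans ?_
    have h1 := ih (fun k => c (k + 1))
    refine add_le_add (h1.trans_eq ?_) ?_
    · congr 1
      refine Finset.sum_congr rfl fun k _ => ?_
      congr 2
      exact tsum_congr fun i => by ring_nf
    · rw [mul_assoc]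
      refine mul_le_mul_right (mul_le_mul_right
        (ENNReal.rpow_le_rpow ?_ (sub_nonneg.2 hs)) _) _
      simp_rw [zero_add]
      rw [add_comm, ← Finset.sum_range_succ']
      exact ENNReal.sum_le_tsum _

lemma tsum_rpow_le_tail {s : ℝ} (hs : 1 ≤ s) (c : ℕ → ℝ≥0∞) :
    (∑' k, c k) ^ s ≤ ENNReal.ofReal s * ∑' k, c k * (∑' i, c (k + i)) ^ (s - 1) := by
  have h := (ENNReal.continuous_rpow_const (y := s)).continuousAt.tendsto.comp
    (ENNReal.summable (f := c)).hasSum.tendsto_sum_nat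
  refine le_of_tendsto' h fun n => (sum_rpow_le_tail hs n c).trans ?_
  gcongr
  exact ENNReal.sum_le_tsum _

lemma tsum_rpow_le_rpow_tsum {ρ : ℝ} (hρ : 1 ≤ ρ) (P : ℕ → ℝ≥0∞) :
    ∑' n, P n ^ ρ ≤ (∑' n, P n) ^ ρ := by
  have e (x : ℝ≥0∞) : x ^ ρ = x * x ^ (ρ - 1) := by
    conv_lhs => rw [← add_sub_cancel 1 ρ,
      ENNReal.rpow_add_of_nonneg _ _ zero_le_one (sub_nonneg.2 hρ), ENNReal.rpow_one]
  calc _ = ∑' n, P n * P n ^ (ρ - 1) := tsum_congr fun n => e _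
    _ ≤ ∑' n, P n * (∑' n, P n) ^ (ρ - 1) := by
        refine ENNReal.tsum_le_tsum fun n => ?_
        exact mul_le_mul_right (ENNReal.rpow_le_rpow (ENNReal.le_tsum n) (sub_nonneg.2 hρ)) _
    _ = _ := by rw [ENNReal.tsum_mul_right, ← e]

lemma tsum_mul_le_Lp_Lq {p q : ℝ} (hpq : p.HolderConjugate q) (f g : ℕ → ℝ≥0∞) :
    ∑' n, f n * g n ≤ (∑' n, f n ^ p) ^ (1 / p) * (∑' n, g n ^ q) ^ (1 / q) := by
  rw [ENNReal.tsum_eq_iSup_sum]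
  refine iSup_le fun F => (ENNReal.inner_le_Lp_mul_Lq F f g hpq).trans ?_
  have := hpq.pos
  have := hpq.symm.pos
  gcongr <;> exact ENNReal.sum_le_tsum _

/-- The norm on the finite set `F` dual to the `ℓ^p` norm. -/
def dualNorm (p : ℝ) (β : ℕ → ℝ≥0∞) (F : Finset ℕ) : ℝ≥0∞ :=
  if p = 1 then F.sup β else (∑ j ∈ F, β j ^ (p / (p - 1))) ^ ((p - 1) / p)

lemma sum_mul_le_dualNorm {p : ℝ} (hp : 1 ≤ p) (a β : ℕ → ℝ≥0∞) (F : Finset ℕ) :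
    ∑ j ∈ F, a j * β j ≤ (∑ j ∈ F, a j ^ p) ^ (1 / p) * dualNorm p β F := by
  rcases hp.eq_or_lt with rfl | hp
  · simp only [dualNorm, if_true, ENNReal.rpow_one, div_one, Finset.sum_mul]
    exact Finset.sum_le_sum fun j hj => by gcongr; exact Finset.le_sup hj
  · rw [dualNorm, if_neg hp.ne']
    have := ENNReal.inner_le_Lp_mul_Lq F a β (Real.HolderConjugate.conjExponent hp)
    simpa only [Real.conjExponent, one_div_div] using this

lemma dualNorm_mono {p : ℝ} (hp : 1 ≤ p) (β : ℕ → ℝ≥0∞) {F G : Finset ℕ} (h : F ⊆ G) :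
    dualNorm p β F ≤ dualNorm p β G := by
  unfold dualNorm
  split_ifs
  · exact Finset.sup_mono h
  · have : 0 ≤ p - 1 := by linarith
    gcongr

lemma dualNorm_union_le {p : ℝ} (hp : 1 ≤ p) (β : ℕ → ℝ≥0∞) (F G : Finset ℕ) :
    dualNorm p β (F ∪ G) ≤ dualNorm p β F + dualNorm p β G := by
  unfold dualNorm
  split_ifs
  · rw [Finset.sup_union]
    exact sup_le le_self_add le_add_self
  · have h0 : 0 ≤ p - 1 := by linarith
    refine le_trans ?_ (ENNReal.rpow_add_le_add_rpow _ _ (by positivity)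
      (by rw [div_le_one (by linarith)]; linarith))
    gcongr
    rw [← Finset.sum_union_inter]
    exact le_self_add

lemma dualNorm_ne_top {p : ℝ} (hp : 1 ≤ p) {β : ℕ → ℝ≥0∞} (hβ : ∀ j, β j ≠ ⊤) (F : Finset ℕ) :
    dualNorm p β F ≠ ⊤ := by
  have h0 : 0 ≤ p - 1 := by linarith
  unfold dualNorm
  split_ifs
  · exact ((Finset.sup_lt_iff (by simp)).2 fun j _ => (hβ j).lt_top).ne
  · refine ENNReal.rpow_ne_top_of_nonneg (by positivity) ?_
    exact ENNReal.sum_ne_top.2 fun j _ => ENNReal.rpow_ne_top_of_nonneg (by positivity) (hβ j)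

lemma exists_dualNorm_le {p : ℝ} (hp : 1 ≤ p) {β : ℕ → ℝ≥0∞} (hβ : ∀ j, β j ≠ ⊤)
    (F : Finset ℕ) :
    ∃ b : ℕ → ℝ≥0∞, ∑' j, b j ^ p ≤ 1 ∧ dualNorm p β F ≤ ∑ j ∈ F, b j * β j := by
  have hp0 : 0 < p := by linarith
  rcases eq_or_ne (dualNorm p β F) 0 with h0 | h0
  · exact ⟨0, by simp [hp0], by simp [h0]⟩
  rcases hp.eq_or_lt with rfl | hp
  · simp only [dualNorm, if_true] at h0 ⊢
    obtain ⟨j, hj, hj'⟩ := Finset.exists_mem_eq_sup F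
      (Finset.nonempty_iff_ne_empty.2 fun h => h0 (by simp [h])) β
    refine ⟨Pi.single j 1, ?_, ?_⟩
    · simp only [ENNReal.rpow_one]
      rw [tsum_pi_single]
    · rw [hj', Finset.sum_eq_single_of_mem j hj]
      · simp
      · intro i _ hi; simp [hi]
  · have h1 : 0 < p - 1 := by linarith
    rw [dualNorm, if_neg hp.ne'] at h0 ⊢
    set W := ∑ j ∈ F, β j ^ (p / (p - 1)) with hW
    have hW0 : W ≠ 0 := by
      rintro h; rw [h, ENNReal.zero_rpow_of_pos (by positivity)] at h0; exact h0 rfl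
    have hWt : W ≠ ⊤ :=
      ENNReal.sum_ne_top.2 fun j _ => ENNReal.rpow_ne_top_of_nonneg (by positivity) (hβ j)
    classical
    refine ⟨fun j => if j ∈ F then β j ^ (1 / (p - 1)) * W ^ (-(1 / p)) else 0, ?_, ?_⟩
    · rw [tsum_eq_sum (s := F) (fun j hj => by simp [hj, hp0])]
      have : ∀ j ∈ F, (if j ∈ F then β j ^ (1 / (p - 1)) * W ^ (-(1 / p)) else 0) ^ p
          = β j ^ (p / (p - 1)) * W⁻¹ := by
        intro j hj
        rw [if_pos hj, ENNReal.mul_rpow_of_nonneg _ _ hp0.le, ← ENNReal.rpow_mul,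
          ← ENNReal.rpow_mul, ← ENNReal.rpow_neg_one]
        congr 2 <;> field_simp
      rw [Finset.sum_congr rfl this, ← Finset.sum_mul, ← hW, ENNReal.mul_inv_cancel hW0 hWt]
    · have : ∀ j ∈ F, (if j ∈ F then β j ^ (1 / (p - 1)) * W ^ (-(1 / p)) else 0) * β j
          = β j ^ (p / (p - 1)) * W ^ (-(1 / p)) := by
        intro j hj
        rw [if_pos hj, mul_right_comm]
        nth_rewrite 2 [← ENNReal.rpow_one (β j)]
        rw [← ENNReal.rpow_add_of_nonneg _ _ (by positivity) zero_le_one]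
        congr 2
        field_simp
        ring
      rw [Finset.sum_congr rfl this, ← Finset.sum_mul, ← hW]
      nth_rewrite 2 [← ENNReal.rpow_one W]
      rw [← ENNReal.rpow_add _ _ hW0 hWt]
      refine le_of_eq ?_
      congr 1
      field_simp
      ring

open Classical in
lemma tsum_mul_partialSum_le_blocks {p r : ℝ} (hp : 1 ≤ p) (hr : 0 < r) (α β a T : ℕ → ℝ≥0∞)
    (hT : ∀ n, T n = ∑ j ∈ Finset.range n, a j * β j) :
    ∑' k, α k * T (k + 1) ^ r ≤ 4 ^ r *
      ∑' n, (if 2 * T (mark T n) < T (n + 1) then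
        ∑ j ∈ Finset.Ico (mark T n) (n + 1), a j ^ p else 0) ^ (r / p) *
        (dualNorm p β (Finset.range (n + 1)) ^ r *
          ∑' k, if mark T (k + 1) = n + 1 then α k else 0) := by
  have h1 : ∑' k, α k * T (k + 1) ^ r ≤ 2 ^ r * ∑' k, α k * T (mark T (k + 1)) ^ r := by
    rw [← ENNReal.tsum_mul_left]
    refine ENNReal.tsum_le_tsum fun k => ?_
    rw [mul_left_comm, ← ENNReal.mul_rpow_of_nonneg _ _ hr.le]
    gcongr
    exact le_two_mul_mark T _
  rw [tsum_mul_comp_mark T α (fun n => T n ^ r) (by simp [hT, hr])] at h1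
  refine h1.trans ?_
  rw [show (4 : ℝ≥0∞) = 2 * 2 by norm_num, ENNReal.mul_rpow_of_nonneg _ _ hr.le, mul_assoc]
  gcongr
  rw [← ENNReal.tsum_mul_left]
  refine ENNReal.tsum_le_tsum fun n => ?_
  by_cases hM : 2 * T (mark T n) < T (n + 1)
  · rw [if_pos hM, ← mul_assoc, ← mul_assoc, mul_comm]
    gcongr
    have hsum : T (n + 1) = T (mark T n) + ∑ j ∈ Finset.Ico (mark T n) (n + 1), a j * β j := by
      rw [hT, hT, Finset.sum_range_add_sum_Ico _ ((mark_le T n).trans (Nat.le_succ n))]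
    have hfin : T (mark T n) ≠ ⊤ := by
      rintro h; simp [h] at hM
    have hle : T (mark T n) ≤ ∑ j ∈ Finset.Ico (mark T n) (n + 1), a j * β j := by
      rw [hsum, two_mul] at hM
      exact (ENNReal.add_le_add_iff_left hfin).1 hM.le
    have h2 : T (n + 1) ≤ 2 * ((∑ j ∈ Finset.Ico (mark T n) (n + 1), a j ^ p) ^ (1 / p) *
        dualNorm p β (Finset.range (n + 1))) := by
      calc T (n + 1) ≤ 2 * ∑ j ∈ Finset.Ico (mark T n) (n + 1), a j * β j := by
            rw [hsum, two_mul]; gcongr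
        _ ≤ _ := by
            gcongr
            refine (sum_mul_le_dualNorm hp a β _).trans ?_
            gcongr
            refine dualNorm_mono hp β fun j hj => ?_
            simp only [Finset.mem_Ico, Finset.mem_range] at hj ⊢
            omega
    calc T (n + 1) ^ r ≤ _ := ENNReal.rpow_le_rpow h2 hr.le
      _ = _ := by
        rw [ENNReal.mul_rpow_of_nonneg _ _ hr.le, ENNReal.mul_rpow_of_nonneg _ _ hr.le,
          ← ENNReal.rpow_mul, one_div_mul_eq_div, mul_assoc]
  · rw [ENNReal.tsum_eq_zero.2 fun k => if_neg fun h => hM (of_mark_succ_eq h).2]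
    simp

lemma tsum_mark_eq_le_tail (T α : ℕ → ℝ≥0∞) (n : ℕ) :
    (∑' k, if mark T (k + 1) = n + 1 then α k else 0) ≤ ∑' i, α (n + i) := by
  rw [tsum_shift_eq]
  refine ENNReal.tsum_le_tsum fun k => ?_
  split_ifs with h h'
  · exact le_rfl
  · exact absurd (of_mark_succ_eq h).1 h'
  all_goals exact zero_le

lemma hardy_le_of_le {p r : ℝ} (hp : 1 ≤ p) (hpr : p ≤ r) (α β a : ℕ → ℝ≥0∞) {B : ℝ≥0∞}
    (hB : ∀ k, (∑' i, α (k + i)) * dualNorm p β (Finset.range (k + 1)) ^ r ≤ B) :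
    ∑' k, α k * (∑ j ∈ Finset.range (k + 1), a j * β j) ^ r
      ≤ 4 ^ r * B * (∑' k, a k ^ p) ^ (r / p) := by
  have hp0 : 0 < p := by linarith
  set T : ℕ → ℝ≥0∞ := fun n => ∑ j ∈ Finset.range n, a j * β j with hT
  refine (tsum_mul_partialSum_le_blocks hp (by linarith) α β a T fun n => rfl).trans ?_
  rw [mul_assoc]
  gcongr
  refine (ENNReal.tsum_le_tsum fun n => mul_le_mul_right (b := _) (c := B) ?_ _).trans ?_
  · rw [mul_comm]
    refine le_trans ?_ (hB n)
    exact mul_le_mul_left (tsum_mark_eq_le_tail _ _ _) _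
  · rw [ENNReal.tsum_mul_right, mul_comm]
    gcongr
    refine (tsum_rpow_le_rpow_tsum ((one_le_div hp0).2 hpr) _).trans ?_
    exact ENNReal.rpow_le_rpow (tsum_blocks_le _ _) (div_nonneg (hp0.le.trans hpr) hp0.le)

lemma hardy_le_of_lt {p r : ℝ} (hp : 1 ≤ p) (hr : 0 < r) (hrp : r < p) (α β a : ℕ → ℝ≥0∞) :
    ∑' k, α k * (∑ j ∈ Finset.range (k + 1), a j * β j) ^ r
      ≤ 4 ^ r * (ENNReal.ofReal (p / (p - r)) *
          ∑' k, α k * (∑' i, α (k + i)) ^ (r / (p - r)) *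
            dualNorm p β (Finset.range (k + 1)) ^ (p * r / (p - r))) ^ ((p - r) / p) *
        (∑' k, a k ^ p) ^ (r / p) := by
  have hp0 : 0 < p := by linarith
  have hd : 0 < p - r := by linarith
  have hs : 1 ≤ p / (p - r) := by rw [one_le_div hd]; linarith
  set T : ℕ → ℝ≥0∞ := fun n => ∑ j ∈ Finset.range n, a j * β j with hT
  have hpq : (p / r).HolderConjugate (p / (p - r)) := by
    rw [Real.holderConjugate_iff]
    refine ⟨(one_lt_div hr).2 hrp, ?_⟩
    field_simp
    ring
  refine (tsum_mul_partialSum_le_blocks hp hr α β a T fun n => rfl).trans ?_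
  rw [mul_assoc]
  gcongr
  refine (tsum_mul_le_Lp_Lq hpq _ _).trans ?_
  rw [mul_comm, one_div_div, one_div_div]
  refine mul_le_mul' (ENNReal.rpow_le_rpow ?_ (by positivity))
    (ENNReal.rpow_le_rpow ?_ (by positivity))
  · simp_rw [ENNReal.mul_rpow_of_nonneg _ _ (zero_le_one.trans hs), ← ENNReal.rpow_mul]
    rw [show r * (p / (p - r)) = p * r / (p - r) by ring]
    have h1 (n : ℕ) : dualNorm p β (Finset.range (n + 1)) ^ (p * r / (p - r)) *
        (∑' k, if mark T (k + 1) = n + 1 then α k else 0) ^ (p / (p - r)) ≤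
        ENNReal.ofReal (p / (p - r)) * ∑' k, if mark T (k + 1) = n + 1 then
          α k * (∑' i, α (k + i)) ^ (r / (p - r)) *
            dualNorm p β (Finset.range (k + 1)) ^ (p * r / (p - r)) else 0 := by
      refine (mul_le_mul_right (tsum_rpow_le_tail hs _) _).trans ?_
      rw [mul_left_comm, ← ENNReal.tsum_mul_left]
      gcongr with k
      split_ifs with h
      · rw [mul_comm]
        rw [show p / (p - r) - 1 = r / (p - r) by field_simp; ring]
        gcongr with i
        · split_ifs
          · exact le_rfl
          · exact zero_le
        · exact dualNorm_mono hp β (Finset.range_subset_range.2 (by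
            have := (of_mark_succ_eq h).1; omega))
      · simp
    refine (ENNReal.tsum_le_tsum h1).trans ?_
    rw [ENNReal.tsum_mul_left, ENNReal.tsum_comm]
    refine mul_le_mul_right (ENNReal.tsum_le_tsum fun k => ?_) _
    cases hk : mark T (k + 1) with
    | zero => simp
    | succ m =>
      rw [tsum_eq_single m]
      · simp
      · intro n hn
        rw [if_neg (by omega)]
  · simp_rw [← ENNReal.rpow_mul]
    rw [show r / p * (p / r) = 1 by field_simp]
    simp_rw [ENNReal.rpow_one]
    exact tsum_blocks_le _ _

lemma le_of_hardy {p r : ℝ} (hp : 1 ≤ p) (hr : 0 < r) {α β : ℕ → ℝ≥0∞} (hβ : ∀ j, β j ≠ ⊤)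
    {C : ℝ≥0∞} (hC : ∀ a : ℕ → ℝ≥0∞, ∑' k, a k ^ p ≠ ⊤ →
      ∑' k, α k * (∑ j ∈ Finset.range (k + 1), a j * β j) ^ r ≤ C * (∑' k, a k ^ p) ^ (r / p))
    (k : ℕ) : (∑' i, α (k + i)) * dualNorm p β (Finset.range (k + 1)) ^ r ≤ C := by
  obtain ⟨b, hb, hb'⟩ := exists_dualNorm_le hp hβ (Finset.range (k + 1))
  calc (∑' i, α (k + i)) * dualNorm p β (Finset.range (k + 1)) ^ r
      ≤ ∑' i, α i * (∑ j ∈ Finset.range (i + 1), b j * β j) ^ r := by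
        rw [tsum_shift_eq, ← ENNReal.tsum_mul_right]
        refine ENNReal.tsum_le_tsum fun i => ?_
        split_ifs with h
        · gcongr
          refine hb'.trans (Finset.sum_le_sum_of_subset ?_)
          exact Finset.range_subset_range.2 (by omega)
        · simp
    _ ≤ C * (∑' k, b k ^ p) ^ (r / p) := hC b (hb.trans_lt ENNReal.one_lt_top).ne
    _ ≤ C * 1 ^ (r / p) := by gcongr
    _ = C := by simp

open Classical in
lemma le_of_hardy_of_lt_of_ne_top {p r : ℝ} (hp : 1 ≤ p) (hr : 0 < r) (hrp : r < p) {α β : ℕ → ℝ≥0∞}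
    (hβ : ∀ j, β j ≠ ⊤) {g : ℝ≥0∞} (hg : g * 2⁻¹ ^ (p * r / (p - r)) + 1 ≤ g) (hgt : g ≠ ⊤)
    {C : ℝ≥0∞} (hC : ∀ a : ℕ → ℝ≥0∞, ∑' k, a k ^ p ≠ ⊤ →
      ∑' k, α k * (∑ j ∈ Finset.range (k + 1), a j * β j) ^ r ≤ C * (∑' k, a k ^ p) ^ (r / p))
    {E : ℝ≥0∞} (hE : E = ∑' k, α k * (∑' i, α (k + i)) ^ (r / (p - r)) *
            dualNorm p β (Finset.range (k + 1)) ^ (p * r / (p - r))) (hEt : E ≠ ⊤) :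
    E ^ ((p - r) / p) ≤ 2 ^ (r + p * r / (p - r)) *
      (ENNReal.ofReal (p / (p - r)) * g) ^ (r / p) * C := by
  have hp0 : 0 < p := by linarith
  have hd : 0 < p - r := by linarith
  have hs : 1 ≤ p / (p - r) := by rw [one_le_div hd]; linarith
  set s := p / (p - r) with hs_def
  set σ := p * r / (p - r) with hσ_def
  have hσ : 0 < σ := by positivity
  set V : ℕ → ℝ≥0∞ := fun n => dualNorm p β (Finset.range n) with hV
  have hV0 : V 0 = 0 := by
    simp only [hV, Finset.range_zero, dualNorm]
    split_ifs with h
    · simp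
    · have : 1 < p := lt_of_le_of_ne hp (Ne.symm h)
      rw [Finset.sum_empty, ENNReal.zero_rpow_of_pos]
      exact div_pos (by linarith) hp0
  have hVmono : Monotone V := fun m n h => dualNorm_mono hp β (Finset.range_subset_range.2 h)
  set A : ℕ → ℝ≥0∞ := fun k => ∑' i, α (k + i) with hA
  have hAanti {m n : ℕ} (h : m ≤ n) : A n ≤ A m := by
    simp only [hA, tsum_shift_eq]
    gcongr with k
    split_ifs
    · exact le_rfl
    · omega
    all_goals exact zero_le
  set D : ℝ≥0∞ :=
    ∑' n, if 2 * V (mark V n) < V (n + 1) then V (n + 1) ^ σ * A n ^ s else 0 with hD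
  have hDE : D ≤ ENNReal.ofReal s * g * E := by
    have h1 (n : ℕ) : A n ^ s ≤ ENNReal.ofReal s *
        ∑' k, if n ≤ k then α k * A k ^ (r / (p - r)) else 0 := by
      refine (tsum_rpow_le_tail hs fun i => α (n + i)).trans_eq ?_
      rw [← tsum_shift_eq fun k => α k * A k ^ (r / (p - r)),
        show s - 1 = r / (p - r) by rw [hs_def]; field_simp; ring]
      simp only [hA, add_assoc]
    calc D ≤ ∑' n, ENNReal.ofReal s * ∑' k, (if n < k + 1 then
            (if 2 * V (mark V n) < V (n + 1) then V (n + 1) ^ σ else 0) else 0) *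
              (α k * A k ^ (r / (p - r))) := by
          refine ENNReal.tsum_le_tsum fun n => ?_
          split_ifs with h
          · refine (mul_le_mul_right (h1 n) _).trans_eq ?_
            rw [mul_left_comm, ← ENNReal.tsum_mul_left]
            congr 1
            refine tsum_congr fun k => ?_
            simp only [Nat.lt_succ_iff]
            split_ifs <;> simp
          · exact zero_le
      _ = ENNReal.ofReal s * ∑' k, (∑ n ∈ Finset.range (k + 1),
            if 2 * V (mark V n) < V (n + 1) then V (n + 1) ^ σ else 0) *
              (α k * A k ^ (r / (p - r))) := by
          rw [ENNReal.tsum_mul_left, ENNReal.tsum_comm]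
          congr 1
          refine tsum_congr fun k => ?_
          rw [ENNReal.tsum_mul_right]
          congr 1
          rw [tsum_eq_sum (s := Finset.range (k + 1))]
          · refine Finset.sum_congr rfl fun n hn => ?_
            rw [if_pos (Finset.mem_range.1 hn)]
          · intro n hn
            rw [if_neg (by simpa using hn)]
      _ ≤ ENNReal.ofReal s * ∑' k, (g * V (k + 1) ^ σ) * (α k * A k ^ (r / (p - r))) := by
          gcongr with k
          refine (sum_marked_rpow_le hσ hg (k + 1)).trans ?_
          gcongr
          exact hVmono (mark_le V _)
      _ = _ := by
          rw [hE, mul_assoc, ← ENNReal.tsum_mul_left (a := g)]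
          congr 1
          refine tsum_congr fun k => ?_
          ring
  have hDt : D ≠ ⊤ := ne_top_of_le_ne_top
    (ENNReal.mul_ne_top (ENNReal.mul_ne_top ENNReal.ofReal_ne_top hgt) hEt) hDE
  choose b hb hb' using fun n => exists_dualNorm_le hp hβ (Finset.Ico (mark V n) (n + 1))
  set lam : ℕ → ℝ≥0∞ := fun n =>
    if 2 * V (mark V n) < V (n + 1) then V (n + 1) ^ (σ / p) * A n ^ (s / p) else 0 with hlam
  set a : ℕ → ℝ≥0∞ := fun j => ⨆ n, lam n * b n j with ha
  have haD : ∑' j, a j ^ p ≤ D := by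
    calc ∑' j, a j ^ p ≤ ∑' j, ∑' n, lam n ^ p * b n j ^ p := by
          gcongr with j
          rw [← ENNReal.le_rpow_inv_iff hp0]
          refine iSup_le fun n => ?_
          rw [ENNReal.le_rpow_inv_iff hp0, ENNReal.mul_rpow_of_nonneg _ _ hp0.le]
          exact ENNReal.le_tsum (f := fun n => lam n ^ p * b n j ^ p) n
      _ = ∑' n, lam n ^ p * ∑' j, b n j ^ p := by
          rw [ENNReal.tsum_comm]; simp_rw [ENNReal.tsum_mul_left]
      _ ≤ ∑' n, lam n ^ p * 1 := by gcongr with n; exact hb n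
      _ = D := by
          refine tsum_congr fun n => ?_
          simp only [hlam, mul_one]
          split_ifs
          · rw [ENNReal.mul_rpow_of_nonneg _ _ hp0.le, ← ENNReal.rpow_mul, ← ENNReal.rpow_mul,
              div_mul_cancel₀ _ hp0.ne', div_mul_cancel₀ _ hp0.ne']
          · simp [hp0]
  have hterm (k : ℕ) : A k ^ (r / (p - r)) * V (k + 1) ^ σ ≤
      2 ^ (r + σ) * (∑ j ∈ Finset.range (k + 1), a j * β j) ^ r := by
    have hVk := le_two_mul_mark V (k + 1)
    cases hk : mark V (k + 1) with
    | zero =>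
      rw [hk, hV0, mul_zero, nonpos_iff_eq_zero] at hVk
      simp [hVk, hσ]
    | succ n =>
      rw [hk] at hVk
      obtain ⟨hnk, hM⟩ := of_mark_succ_eq hk
      have hVfin : V (mark V n) ≠ ⊤ := dualNorm_ne_top hp hβ _
      have hblock : V (n + 1) ≤ 2 * dualNorm p β (Finset.Ico (mark V n) (n + 1)) := by
        have h1 : V (n + 1) ≤ V (mark V n) + dualNorm p β (Finset.Ico (mark V n) (n + 1)) := by
          refine le_trans (dualNorm_mono hp β ?_) (dualNorm_union_le hp β _ _)
          intro j hj
          simp only [Finset.mem_union, Finset.mem_Ico, Finset.mem_range] at hj ⊢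
          omega
        have h2 : V (mark V n) ≤ dualNorm p β (Finset.Ico (mark V n) (n + 1)) := by
          rw [two_mul] at hM
          exact (ENNReal.add_le_add_iff_left hVfin).1 (hM.le.trans h1)
        rw [two_mul]
        exact h1.trans (by gcongr)
      have hsum : lam n * V (n + 1) ≤ 2 * ∑ j ∈ Finset.range (k + 1), a j * β j := by
        calc lam n * V (n + 1)
            ≤ lam n * (2 * ∑ j ∈ Finset.Ico (mark V n) (n + 1), b n j * β j) := by
              gcongr; exact hblock.trans (by gcongr; exact hb' n)
          _ = 2 * ∑ j ∈ Finset.Ico (mark V n) (n + 1), lam n * b n j * β j := by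
              rw [mul_left_comm, Finset.mul_sum]; simp_rw [mul_assoc]
          _ ≤ 2 * ∑ j ∈ Finset.Ico (mark V n) (n + 1), a j * β j := by
              gcongr with j
              exact le_iSup (fun n => lam n * b n j) n
          _ ≤ _ := by
              gcongr
              intro j hj
              simp only [Finset.mem_Ico, Finset.mem_range] at hj ⊢
              omega
      have hlamV : (lam n * V (n + 1)) ^ r = A n ^ (r / (p - r)) * V (n + 1) ^ σ := by
        simp only [hlam, if_pos hM]
        have e1 : V (n + 1) ^ (σ / p) * A n ^ (s / p) * V (n + 1) =
            A n ^ (s / p) * V (n + 1) ^ s := by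
          rw [mul_right_comm, mul_comm]
          congr 1
          nth_rewrite 2 [← ENNReal.rpow_one (V (n + 1))]
          rw [← ENNReal.rpow_add_of_nonneg _ _ (by positivity) zero_le_one]
          congr 1
          rw [hσ_def, hs_def]
          field_simp
          ring
        rw [e1, ENNReal.mul_rpow_of_nonneg _ _ hr.le, ← ENNReal.rpow_mul, ← ENNReal.rpow_mul]
        congr 2
        · rw [hs_def]; field_simp
        · rw [hs_def, hσ_def]; ring
      calc A k ^ (r / (p - r)) * V (k + 1) ^ σ
          ≤ A n ^ (r / (p - r)) * (2 * V (n + 1)) ^ σ := by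
            gcongr
            exact hAanti hnk
        _ = 2 ^ σ * (lam n * V (n + 1)) ^ r := by
            rw [hlamV, ENNReal.mul_rpow_of_nonneg _ _ hσ.le]; ring
        _ ≤ 2 ^ σ * (2 * ∑ j ∈ Finset.range (k + 1), a j * β j) ^ r := by gcongr
        _ = _ := by
            rw [ENNReal.mul_rpow_of_nonneg _ _ hr.le,
              ENNReal.rpow_add _ _ (by simp) (by simp)]
            ring
  have hmain : E ≤ 2 ^ (r + σ) * (ENNReal.ofReal s * g) ^ (r / p) * C * E ^ (r / p) := by
    calc E ≤ ∑' k, 2 ^ (r + σ) * (α k * (∑ j ∈ Finset.range (k + 1), a j * β j) ^ r) := by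
          rw [hE]
          refine ENNReal.tsum_le_tsum fun k => ?_
          rw [mul_assoc, mul_left_comm (2 ^ (r + σ))]
          exact mul_le_mul_right (hterm k) _
      _ ≤ 2 ^ (r + σ) * (C * (∑' j, a j ^ p) ^ (r / p)) := by
          rw [ENNReal.tsum_mul_left]
          gcongr
          exact hC a (ne_top_of_le_ne_top hDt haD)
      _ ≤ 2 ^ (r + σ) * (C * (ENNReal.ofReal s * g * E) ^ (r / p)) := by
          gcongr
          exact haD.trans hDE
      _ = _ := by
          rw [ENNReal.mul_rpow_of_nonneg (ENNReal.ofReal s * g) E (by positivity)]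
          ring
  rcases eq_or_ne E 0 with h0 | h0
  · rw [h0, ENNReal.zero_rpow_of_pos (by positivity)]
    exact zero_le
  have hEr : E = E ^ ((p - r) / p) * E ^ (r / p) := by
    rw [← ENNReal.rpow_add _ _ h0 hEt, ← add_div, sub_add_cancel, div_self hp0.ne',
      ENNReal.rpow_one]
  have ht : E ^ (r / p) ≠ ⊤ := ENNReal.rpow_ne_top_of_nonneg (by positivity) hEt
  have h0' : E ^ (r / p) ≠ 0 := (ENNReal.rpow_pos (pos_iff_ne_zero.2 h0) hEt).ne'
  exact (ENNReal.mul_le_mul_iff_left h0' ht).1 (hEr.symm.trans_le hmain)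

lemma tendsto_tail_truncate (α : ℕ → ℝ≥0∞) (k : ℕ) :
    Filter.Tendsto (fun n => ∑' i, if k + i < n then α (k + i) else 0) Filter.atTop
      (nhds (∑' i, α (k + i))) := by
  have h := (ENNReal.summable (f := fun i => α (k + i))).hasSum.tendsto_sum_nat.comp
    (Filter.tendsto_sub_atTop_nat k)
  refine h.congr fun n => ?_
  rw [tsum_eq_sum (s := Finset.range (n - k))]
  · refine Finset.sum_congr rfl fun i hi => (if_pos ?_).symm
    have := Finset.mem_range.1 hi
    omega
  · intro i hi
    refine if_neg ?_
    have := mt Finset.mem_range.2 hi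
    omega

lemma le_of_hardy_of_lt {p r : ℝ} (hp : 1 ≤ p) (hr : 0 < r) (hrp : r < p) {α β : ℕ → ℝ≥0∞}
    (hα : ∀ k, α k ≠ ⊤) (hβ : ∀ j, β j ≠ ⊤) {g : ℝ≥0∞}
    (hg : g * 2⁻¹ ^ (p * r / (p - r)) + 1 ≤ g) (hgt : g ≠ ⊤)
    {C : ℝ≥0∞} (hC : ∀ a : ℕ → ℝ≥0∞, ∑' k, a k ^ p ≠ ⊤ →
      ∑' k, α k * (∑ j ∈ Finset.range (k + 1), a j * β j) ^ r ≤ C * (∑' k, a k ^ p) ^ (r / p)) :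
    (∑' k, α k * (∑' i, α (k + i)) ^ (r / (p - r)) *
      dualNorm p β (Finset.range (k + 1)) ^ (p * r / (p - r))) ^ ((p - r) / p) ≤
      2 ^ (r + p * r / (p - r)) * (ENNReal.ofReal (p / (p - r)) * g) ^ (r / p) * C := by
  have hp0 : 0 < p := by linarith
  have hd : 0 < p - r := by linarith
  set V : ℕ → ℝ≥0∞ := fun k =>
    dualNorm p β (Finset.range (k + 1)) ^ (p * r / (p - r)) with hV
  have hVt (k : ℕ) : V k ≠ ⊤ :=
    ENNReal.rpow_ne_top_of_nonneg (by positivity) (dualNorm_ne_top hp hβ _)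
  set αt : ℕ → ℕ → ℝ≥0∞ := fun n k => if k < n then α k else 0 with hαt
  have hαt_le (n k : ℕ) : αt n k ≤ α k := by
    simp only [hαt]
    split_ifs
    · exact le_rfl
    · exact zero_le
  have hαt_ne (n k : ℕ) : αt n k ≠ ⊤ := ne_top_of_le_ne_top (hα k) (hαt_le n k)
  have htail (n k : ℕ) : ∑' i, αt n (k + i) ≠ ⊤ := by
    rw [tsum_eq_sum (s := Finset.range n)]
    · exact ENNReal.sum_ne_top.2 fun i _ => hαt_ne _ _
    · intro i hi
      have := mt Finset.mem_range.2 hi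
      exact if_neg (by omega)
  set M := 2 ^ (r + p * r / (p - r)) * (ENNReal.ofReal (p / (p - r)) * g) ^ (r / p) * C
  have hfin (n : ℕ) : ∑' k, αt n k * (∑' i, αt n (k + i)) ^ (r / (p - r)) * V k ≠ ⊤ := by
    rw [tsum_eq_sum (s := Finset.range n)]
    · refine ENNReal.sum_ne_top.2 fun k _ => ENNReal.mul_ne_top (ENNReal.mul_ne_top
        (hαt_ne n k) (ENNReal.rpow_ne_top_of_nonneg (by positivity) (htail n k))) (hVt k)
    · intro k hk
      simp [hαt, show ¬ k < n from fun h => hk (Finset.mem_range.2 h)]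
  have htrunc (n : ℕ) : ∑' k, αt n k * (∑' i, αt n (k + i)) ^ (r / (p - r)) * V k ≤
      M ^ (p / (p - r)) := by
    have h := le_of_hardy_of_lt_of_ne_top (α := αt n) hp hr hrp hβ hg hgt (C := C)
      (fun a ha => le_trans (by gcongr; exact hαt_le n _) (hC a ha)) rfl (hfin n)
    have h2 := ENNReal.rpow_le_rpow h (z := p / (p - r)) (by positivity)
    rwa [← ENNReal.rpow_mul, show (p - r) / p * (p / (p - r)) = 1 by field_simp,
      ENNReal.rpow_one] at h2
  have hle : ∑' k, α k * (∑' i, α (k + i)) ^ (r / (p - r)) * V k ≤ M ^ (p / (p - r)) := by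
    rw [ENNReal.tsum_eq_iSup_nat]
    refine iSup_le fun K => ?_
    have hlim : Filter.Tendsto
        (fun n => ∑ k ∈ Finset.range K, α k * (∑' i, αt n (k + i)) ^ (r / (p - r)) * V k)
        Filter.atTop
        (nhds (∑ k ∈ Finset.range K, α k * (∑' i, α (k + i)) ^ (r / (p - r)) * V k)) := by
      refine tendsto_finsetSum _ fun k _ => ?_
      refine ENNReal.Tendsto.mul_const (ENNReal.Tendsto.const_mul ?_ (Or.inr (hα k)))
        (Or.inr (hVt k))
      exact (ENNReal.continuous_rpow_const.tendsto _).comp (tendsto_tail_truncate α k)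
    refine le_of_tendsto hlim ?_
    filter_upwards [Filter.eventually_ge_atTop K] with n hn
    refine le_trans ?_ (htrunc n)
    refine le_trans (Finset.sum_le_sum fun k hk => ?_) (ENNReal.sum_le_tsum (Finset.range K))
    have : k < n := (Finset.mem_range.1 hk).trans_le hn
    simp [hαt, this]
  have h2 := ENNReal.rpow_le_rpow hle (z := (p - r) / p) (by positivity)
  rwa [← ENNReal.rpow_mul, show p / (p - r) * ((p - r) / p) = 1 by field_simp,
    ENNReal.rpow_one] at h2

lemma exists_geometric_bound {t : ℝ≥0∞} (ht : t < 1) :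
    ∃ g : ℝ≥0∞, g ≠ ⊤ ∧ g * t + 1 ≤ g := by
  have h0 : 1 - t ≠ 0 := (tsub_pos_of_lt ht).ne'
  refine ⟨(1 - t)⁻¹, ENNReal.inv_ne_top.2 h0, le_of_eq ?_⟩
  nth_rewrite 2 [← ENNReal.inv_mul_cancel h0 (by simp)]
  rw [← mul_add, add_tsub_cancel_of_le ht.le, mul_one]

lemma io_coe (x y : ℝ) : io x y = Ioo x y := by
  ext t; simp [io]

lemma setLIntegral_io_add (f : ℝ → ℝ≥0∞) {x y z : ℝ} (hxy : x ≤ y) (hyz : y ≤ z) :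
    ∫⁻ s in io x z, f s = (∫⁻ s in io x y, f s) + ∫⁻ s in io y z, f s := by
  simp only [io_coe, setLIntegral_congr Ioo_ae_eq_Ioc]
  rw [← Ioc_union_Ioc_eq_Ioc hxy hyz,
    lintegral_union measurableSet_Ioc (Ioc_disjoint_Ioc_of_le le_rfl)]

lemma essSup_io_eq_max (f : ℝ → ℝ≥0∞) {x y z : ℝ} (hxy : x ≤ y) (hyz : y ≤ z) :
    essSup f (volume.restrict (io x z)) =
      max (essSup f (volume.restrict (io x y))) (essSup f (volume.restrict (io y z))) := by
  simp only [io_coe, Measure.restrict_congr_set Ioo_ae_eq_Ioc]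
  rw [← Ioc_union_Ioc_eq_Ioc hxy hyz]
  apply le_antisymm
  · refine essSup_le_of_ae_le _ ?_
    refine (ae_restrict_union_iff _ _ _).2 ⟨?_, ?_⟩
    · filter_upwards [ae_le_essSup f] with s hs using hs.trans (le_max_left _ _)
    · filter_upwards [ae_le_essSup f] with s hs using hs.trans (le_max_right _ _)
  · refine max_le ?_ ?_ <;> refine essSup_mono_measure (Measure.absolutelyContinuous_of_le
      (Measure.restrict_mono_set _ (by simp)))

lemma Vp_eq_dualNorm {p : ℝ} (hp : 1 ≤ p) (v : ℝ → ℝ≥0∞) {y : ℕ → ℝ} (hy : Monotone y) (n : ℕ) :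
    Vp p v (y 0) (y n) =
      dualNorm p (fun j => Vp p v (y j) (y (j + 1))) (Finset.range n) := by
  rcases hp.eq_or_lt with rfl | hp
  · simp only [Vp, dualNorm, if_true]
    induction n with
    | zero => simp [io_coe]
    | succ n ih =>
      rw [essSup_io_eq_max _ (hy (Nat.zero_le n)) (hy (Nat.le_succ n)), ih, Finset.range_add_one,
        Finset.sup_insert, max_comm]
  · have h1 : 0 < p - 1 := by linarith
    have h2 : 0 < p := by linarith
    simp only [Vp, dualNorm, if_neg hp.ne', ← ENNReal.rpow_mul]
    simp only [show (p - 1) / p * (p / (p - 1)) = 1 by field_simp, ENNReal.rpow_one]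
    congr 1
    induction n with
    | zero => simp [io_coe]
    | succ n ih =>
      rw [setLIntegral_io_add _ (hy (Nat.zero_le n)) (hy (Nat.le_succ n)), ih,
        Finset.sum_range_succ]

lemma setLIntegral_Ioo_ne_zero {f : ℝ → ℝ≥0∞} (hf : Measurable f) {x y : ℝ} (hxy : x < y)
    (hpos : ∀ s ∈ Ioo x y, f s ≠ 0) : ∫⁻ s in Ioo x y, f s ≠ 0 := by
  refine ((setLIntegral_pos_iff hf).2 ?_).ne'
  rw [inter_eq_right.2 (show Ioo x y ⊆ Function.support f from hpos)]
  simpa using hxy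

lemma Vp_ne_zero {p : ℝ} (hp : 1 ≤ p) {v : ℝ → ℝ≥0∞} (hv : Measurable v) {x y : ℝ}
    (hxy : x < y) (hfin : ∀ s ∈ Ioo x y, v s ≠ ⊤) : Vp p v x y ≠ 0 := by
  unfold Vp
  rw [io_coe]
  split_ifs with h
  · rw [Ne, ENNReal.essSup_eq_zero_iff]
    intro h0
    have : ∀ᵐ s ∂volume.restrict (Ioo x y), False := by
      filter_upwards [h0, ae_restrict_mem measurableSet_Ioo] with s hs hs'
      exact hfin s hs' (by simpa using hs)
    simp only [Filter.eventually_false_iff_eq_bot, ae_eq_bot, Measure.restrict_eq_zero,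
      Real.volume_Ioo, ENNReal.ofReal_eq_zero] at this
    linarith
  · have hp1 : 1 < p := lt_of_le_of_ne hp (Ne.symm h)
    have h1 : 0 < p - 1 := by linarith
    have h2 : 0 < p := by linarith
    have hI := setLIntegral_Ioo_ne_zero (f := fun s => v s ^ (-(1 / (p - 1))))
      (hv.pow_const _) hxy fun s hs => by
        rw [ENNReal.rpow_neg]
        exact ENNReal.inv_ne_zero.2
          (ENNReal.rpow_ne_top_of_nonneg (by positivity) (hfin s hs))
    rw [Ne, ENNReal.rpow_eq_zero_iff_of_pos (by positivity)]
    exact hI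

lemma ne_top_of_hardy {p r : ℝ} (hp : 1 ≤ p) (hr : 0 < r) {α β : ℕ → ℝ≥0∞}
    (hα0 : ∀ k, α k ≠ 0) (hβ0 : ∀ j, β j ≠ 0) {C : ℝ≥0∞} (hCt : C ≠ ⊤)
    (hC : ∀ a : ℕ → ℝ≥0∞, ∑' k, a k ^ p ≠ ⊤ →
      ∑' k, α k * (∑ j ∈ Finset.range (k + 1), a j * β j) ^ r ≤ C * (∑' k, a k ^ p) ^ (r / p))
    (k : ℕ) : α k ≠ ⊤ ∧ β k ≠ ⊤ := by
  have hp0 : 0 < p := by linarith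
  have hS : ∑' j, (Pi.single k 1 : ℕ → ℝ≥0∞) j ^ p = 1 := by
    rw [tsum_eq_single k]
    · simp
    · intro j hj; simp [hj, hp0]
  have h := hC (Pi.single k 1) (by simp [hS])
  rw [hS, ENNReal.one_rpow, mul_one] at h
  have h' := ne_top_of_le_ne_top hCt ((ENNReal.le_tsum k).trans h)
  rw [Finset.sum_eq_single_of_mem k (by simp) (fun j _ hj => by simp [hj])] at h'
  simp only [Pi.single_eq_same, one_mul] at h'
  have hβr : β k ^ r ≠ 0 := by
    rw [Ne, ENNReal.rpow_eq_zero_iff_of_pos hr]; exact hβ0 k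
  refine ⟨?_, ?_⟩
  · rintro e; rw [e, ENNReal.top_mul hβr] at h'; exact h' rfl
  · rintro e; rw [e, ENNReal.top_rpow_of_pos hr, ENNReal.mul_top (hα0 k)] at h'; exact h' rfl

lemma best_constant_equiv {ι : Type*} (L S : ι → ℝ≥0∞) (B c₂ K : ℝ≥0∞) (hc₂ : c₂ < ⊤)
    (hK0 : K ≠ 0) (hK : K ≠ ⊤) (hle : ∀ a, L a ≤ c₂ * B * S a)
    (hge : ∀ C, C ≠ ⊤ → (∀ a, L a ≤ C * S a) → B ≤ K * C) :
    ((∃ C : ℝ≥0∞, 0 < C ∧ C < ⊤ ∧ ∀ a, L a ≤ C * S a) ↔ B < ⊤) ∧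
      K⁻¹ * B ≤ sInf {C | ∀ a, L a ≤ C * S a} ∧ sInf {C | ∀ a, L a ≤ C * S a} ≤ c₂ * B := by
  refine ⟨⟨?_, fun hB => ⟨c₂ * B + 1, by simp, ?_, fun a => ?_⟩⟩, ?_, sInf_le hle⟩
  · rintro ⟨C, -, hCt, hC⟩
    exact (hge C hCt.ne hC).trans_lt (ENNReal.mul_lt_top hK.lt_top hCt)
  · exact ENNReal.add_lt_top.2 ⟨ENNReal.mul_lt_top hc₂ hB, ENNReal.one_lt_top⟩
  · refine (hle a).trans ?_
    gcongr
    exact le_self_add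
  · refine le_sInf fun C hC => ?_
    rcases eq_or_ne C ⊤ with rfl | hCt
    · exact le_top
    · rw [ENNReal.inv_mul_le_iff hK0 hK]
      exact hge C hCt hC

lemma hardy_of_nnreal {p r : ℝ} (hp : 1 ≤ p) (hr : 0 < r) {α β : ℕ → ℝ≥0∞} {C : ℝ≥0∞}
    (hC : ∀ a : ℕ → ℝ≥0,
      (∑' k, α k * (∑ j ∈ Finset.range (k + 1), (a j : ℝ≥0∞) * β j) ^ r) ^ (1 / r)
        ≤ C * (∑' k, (a k : ℝ≥0∞) ^ p) ^ (1 / p)) (a : ℕ → ℝ≥0∞) (ha : ∑' k, a k ^ p ≠ ⊤) :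
    ∑' k, α k * (∑ j ∈ Finset.range (k + 1), a j * β j) ^ r
      ≤ C ^ r * (∑' k, a k ^ p) ^ (r / p) := by
  have hp0 : 0 < p := by linarith
  have hat (k : ℕ) : a k ≠ ⊤ := by
    rintro h
    have := ENNReal.ne_top_of_tsum_ne_top ha k
    simp [h, hp0] at this
  lift a to ℕ → ℝ≥0 using hat
  have h := hC a
  rw [one_div, ENNReal.rpow_inv_le_iff hr, ENNReal.mul_rpow_of_nonneg _ _ hr.le,
    ← ENNReal.rpow_mul, one_div_mul_eq_div] at h
  exact h

lemma exists_hardy_constants {p r : ℝ} (hp : 1 ≤ p) (hr : 0 < r) :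
    ∃ c₂ K : ℝ≥0∞, c₂ < ⊤ ∧ K ≠ 0 ∧ K ≠ ⊤ ∧
      (p ≤ r → ∀ α β : ℕ → ℝ≥0∞, (∀ k, α k ≠ 0) → (∀ j, β j ≠ 0) →
        (∀ a : ℕ → ℝ≥0,
          (∑' k, α k * (∑ j ∈ Finset.range (k + 1), (a j : ℝ≥0∞) * β j) ^ r) ^ (1 / r) ≤
            c₂ * (⨆ k, (∑' i, α (k + i)) ^ (1 / r) * dualNorm p β (Finset.range (k + 1))) *
              (∑' k, (a k : ℝ≥0∞) ^ p) ^ (1 / p)) ∧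
        ∀ C : ℝ≥0∞, C ≠ ⊤ → (∀ a : ℕ → ℝ≥0,
          (∑' k, α k * (∑ j ∈ Finset.range (k + 1), (a j : ℝ≥0∞) * β j) ^ r) ^ (1 / r) ≤
            C * (∑' k, (a k : ℝ≥0∞) ^ p) ^ (1 / p)) →
          (⨆ k, (∑' i, α (k + i)) ^ (1 / r) * dualNorm p β (Finset.range (k + 1))) ≤ K * C) ∧
      (r < p → ∀ α β : ℕ → ℝ≥0∞, (∀ k, α k ≠ 0) → (∀ j, β j ≠ 0) →
        (∀ a : ℕ → ℝ≥0,
          (∑' k, α k * (∑ j ∈ Finset.range (k + 1), (a j : ℝ≥0∞) * β j) ^ r) ^ (1 / r) ≤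
            c₂ * (∑' k, α k * (∑' i, α (k + i)) ^ (r / (p - r)) *
              dualNorm p β (Finset.range (k + 1)) ^ (p * r / (p - r))) ^ ((p - r) / (p * r)) *
              (∑' k, (a k : ℝ≥0∞) ^ p) ^ (1 / p)) ∧
        ∀ C : ℝ≥0∞, C ≠ ⊤ → (∀ a : ℕ → ℝ≥0,
          (∑' k, α k * (∑ j ∈ Finset.range (k + 1), (a j : ℝ≥0∞) * β j) ^ r) ^ (1 / r) ≤
            C * (∑' k, (a k : ℝ≥0∞) ^ p) ^ (1 / p)) →
          (∑' k, α k * (∑' i, α (k + i)) ^ (r / (p - r)) *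
            dualNorm p β (Finset.range (k + 1)) ^ (p * r / (p - r))) ^ ((p - r) / (p * r)) ≤
              K * C) := by
  have hp0 : 0 < p := by linarith
  rcases le_or_gt p r with hpr | hrp
  · refine ⟨4, 1, by simp, one_ne_zero, ENNReal.one_ne_top, fun _ α β hα0 hβ0 => ⟨fun a => ?_,
      fun C hCt hC => ?_⟩, fun h => absurd hpr (not_le.2 h)⟩
    · set B := ⨆ k, (∑' i, α (k + i)) ^ (1 / r) * dualNorm p β (Finset.range (k + 1)) with hB
      have h := hardy_le_of_le hp hpr α β (fun k => a k) (B := B ^ r) fun k => by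
        have h1 := ENNReal.rpow_le_rpow (le_iSup (fun k => (∑' i, α (k + i)) ^ (1 / r) *
          dualNorm p β (Finset.range (k + 1))) k) hr.le
        rwa [ENNReal.mul_rpow_of_nonneg _ _ hr.le, ← ENNReal.rpow_mul, one_div_mul_cancel hr.ne',
          ENNReal.rpow_one] at h1
      rw [one_div, ENNReal.rpow_inv_le_iff hr, ENNReal.mul_rpow_of_nonneg _ _ hr.le,
        ENNReal.mul_rpow_of_nonneg _ _ hr.le, ← ENNReal.rpow_mul, one_div_mul_eq_div]
      exact h
    · have hC' := hardy_of_nnreal hp hr hC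
      have hfin := ne_top_of_hardy hp hr hα0 hβ0 (ENNReal.rpow_ne_top_of_nonneg hr.le hCt) hC'
      rw [one_mul]
      refine iSup_le fun k => ?_
      have h := le_of_hardy hp hr (fun j => (hfin j).2) hC' k
      rwa [← ENNReal.rpow_le_rpow_iff hr, ENNReal.mul_rpow_of_nonneg _ _ hr.le,
        ← ENNReal.rpow_mul, one_div_mul_cancel hr.ne', ENNReal.rpow_one]
  · have hd : 0 < p - r := by linarith
    obtain ⟨g, hgt, hg⟩ := exists_geometric_bound (t := 2⁻¹ ^ (p * r / (p - r)))
      (ENNReal.rpow_lt_one (by simp) (by positivity))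
    have hs : ENNReal.ofReal (p / (p - r)) ≠ ⊤ := ENNReal.ofReal_ne_top
    set M : ℝ≥0∞ := 2 ^ (r + p * r / (p - r)) *
      (ENNReal.ofReal (p / (p - r)) * g) ^ (r / p) with hM
    have hMt : M ≠ ⊤ := ENNReal.mul_ne_top
      (ENNReal.rpow_ne_top_of_nonneg (by positivity) (by simp))
      (ENNReal.rpow_ne_top_of_nonneg (by positivity) (ENNReal.mul_ne_top hs hgt))
    refine ⟨4 * ENNReal.ofReal (p / (p - r)) ^ ((p - r) / (p * r)), M ^ (1 / r) + 1, ?_, by simp,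
      ENNReal.add_ne_top.2 ⟨ENNReal.rpow_ne_top_of_nonneg (by positivity) hMt, by simp⟩,
      fun h => absurd h (not_le.2 hrp), fun _ α β hα0 hβ0 => ⟨fun a => ?_, fun C hCt hC => ?_⟩⟩
    · exact ENNReal.mul_lt_top (by simp)
        (ENNReal.rpow_ne_top_of_nonneg (by positivity) hs).lt_top
    · have h := hardy_le_of_lt hp hr hrp α β (fun k => a k)
      have e : (p - r) / (p * r) * r = (p - r) / p := by field_simp
      rw [one_div, ENNReal.rpow_inv_le_iff hr]
      simp only [ENNReal.mul_rpow_of_nonneg _ _ hr.le, ← ENNReal.rpow_mul, one_div_mul_eq_div, e]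
      rw [ENNReal.mul_rpow_of_nonneg _ _ (show 0 ≤ (p - r) / p by positivity), ← mul_assoc] at h
      exact h
    · have hC' := hardy_of_nnreal hp hr hC
      have hfin := ne_top_of_hardy hp hr hα0 hβ0 (ENNReal.rpow_ne_top_of_nonneg hr.le hCt) hC'
      have h := le_of_hardy_of_lt hp hr hrp (fun j => (hfin j).1) (fun j => (hfin j).2) hg hgt hC'
      have h2 := ENNReal.rpow_le_rpow h (z := 1 / r) (by positivity)
      rw [← ENNReal.rpow_mul, ENNReal.mul_rpow_of_nonneg _ _ (by positivity),
        ← ENNReal.rpow_mul C, mul_one_div_cancel hr.ne', ENNReal.rpow_one,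
        show (p - r) / p * (1 / r) = (p - r) / (p * r) by field_simp] at h2
      refine h2.trans ?_
      gcongr
      exact le_self_add

theorem discrete_characterization (p q r : ℝ) (hp : 1 ≤ p) (hq : 0 < q) (hr : 0 < r)
    (d₁ d₂ : ℝ≥0∞) (hd₁ : 0 < d₁) (hd₂ : d₂ < ⊤) :
    ∃ c₁ c₂ : ℝ≥0∞, 0 < c₁ ∧ c₂ < ⊤ ∧
      ∀ (a b : EReal), a < b → ∀ u v w : ℝ → ℝ≥0∞,
        IsWeight a b u → IsWeight a b v → IsWeight a b w →
        ∀ (N : ℤ) (x : ℤ → ℝ), IsDiscretizing a b w N x d₁ d₂ →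
        (p ≤ r →
          ((∃ C : ℝ≥0∞, 0 < C ∧ C < ⊤ ∧ ∀ aseq : ℕ → ℝ≥0,
              lhsSeq N x p q r u v aseq ≤ C * (∑' k : ℕ, (aseq k : ℝ≥0∞) ^ p) ^ (1 / p)) ↔
            B1 a N x p q r u v < ⊤) ∧
          c₁ * B1 a N x p q r u v ≤ bestSeq N x p q r u v ∧
          bestSeq N x p q r u v ≤ c₂ * B1 a N x p q r u v) ∧
        (r < p →
          ((∃ C : ℝ≥0∞, 0 < C ∧ C < ⊤ ∧ ∀ aseq : ℕ → ℝ≥0,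
              lhsSeq N x p q r u v aseq ≤ C * (∑' k : ℕ, (aseq k : ℝ≥0∞) ^ p) ^ (1 / p)) ↔
            B2 a N x p q r u v < ⊤) ∧
          c₁ * B2 a N x p q r u v ≤ bestSeq N x p q r u v ∧
          bestSeq N x p q r u v ≤ c₂ * B2 a N x p q r u v) := by
  have hp0 : 0 < p := by linarith
  obtain ⟨c₂, K, hc₂, hK0, hK, hB1, hB2⟩ := exists_hardy_constants hp hr
  refine ⟨K⁻¹, c₂, ENNReal.inv_pos.2 hK, hc₂, ?_⟩
  intro a b _ u v w hu hv _ N x ⟨hxa, hxmono, hxab, _⟩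
  set α : ℕ → ℝ≥0∞ := fun k => (2 : ℝ≥0∞) ^ (-((N + 1 + k : ℤ) : ℝ)) *
    (∫⁻ t in Ioo (x (N + 1 + k)) (x (N + 2 + k)), u t) ^ (r / q) with hα
  set β : ℕ → ℝ≥0∞ := fun j => Vp p v (x (N + j)) (x (N + 1 + j)) with hβ
  have hIoo (k : ℕ) {s : ℝ} (hs : s ∈ Ioo (x (N + k)) (x (N + 1 + k))) : s ∈ io a b := by
    refine ⟨(hxab (N + k) (by omega)).1.trans_lt (EReal.coe_lt_coe_iff.2 hs.1),
      (EReal.coe_lt_coe_iff.2 hs.2).trans_le (hxab (N + 1 + k) (by omega)).2⟩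
  have hlt (k : ℕ) : x (N + k) < x (N + 1 + k) := by
    have := hxmono (N + k) (by omega)
    rwa [show N + (k : ℤ) + 1 = N + 1 + k by ring] at this
  have hα0 (k : ℕ) : α k ≠ 0 := by
    have h1 := hlt (k + 1)
    have h2 := fun s => hIoo (k + 1) (s := s)
    rw [show N + ((k + 1 : ℕ) : ℤ) = N + 1 + k by push_cast; ring,
      show N + 1 + ((k + 1 : ℕ) : ℤ) = N + 2 + k by push_cast; ring] at h1 h2
    refine mul_ne_zero (ENNReal.rpow_pos (by simp) (by simp)).ne' ?_
    rw [Ne, ENNReal.rpow_eq_zero_iff_of_pos (by positivity)]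
    exact setLIntegral_Ioo_ne_zero hu.1 h1 fun s hs => (hu.2 s (h2 s hs)).1.ne'
  have hβ0 (k : ℕ) : β k ≠ 0 :=
    Vp_ne_zero hp hv.1 (hlt k) fun s hs => (hv.2 s (hIoo k hs)).2.ne
  have hV (k : ℕ) : Vp p v a (x (N + 1 + k)) = dualNorm p β (Finset.range (k + 1)) := by
    have hy : Monotone fun j : ℕ => x (N + j) := by
      refine monotone_nat_of_le_succ fun j => ?_
      rw [show N + ((j + 1 : ℕ) : ℤ) = N + 1 + j by push_cast; ring]
      exact (hlt j).le
    have h := Vp_eq_dualNorm hp v hy (k + 1)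
    simp only [Nat.cast_zero, add_zero, hxa, Nat.cast_add, Nat.cast_one] at h
    simpa only [hβ, add_assoc, add_comm (1 : ℤ)] using h
  have hA (k i : ℕ) : (2 : ℝ≥0∞) ^ (-((N + 1 + k + i : ℤ) : ℝ)) *
      (∫⁻ t in Ioo (x (N + 1 + k + i)) (x (N + 2 + k + i)), u t) ^ (r / q) = α (k + i) := by
    simp only [hα, Nat.cast_add, add_assoc]
  have hL (aseq : ℕ → ℝ≥0) : lhsSeq N x p q r u v aseq =
      (∑' k, α k * (∑ j ∈ Finset.range (k + 1), (aseq j : ℝ≥0∞) * β j) ^ r) ^ (1 / r) := rfl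
  have e1 : B1 a N x p q r u v =
      ⨆ k, (∑' i, α (k + i)) ^ (1 / r) * dualNorm p β (Finset.range (k + 1)) := by
    simp only [B1, hV, hA]
  have e2 : B2 a N x p q r u v = (∑' k, α k * (∑' i, α (k + i)) ^ (r / (p - r)) *
      dualNorm p β (Finset.range (k + 1)) ^ (p * r / (p - r))) ^ ((p - r) / (p * r)) := by
    simp only [B2, hV, hA]
    rfl
  unfold bestSeq
  rw [e1, e2]
  simp only [hL]
  refine ⟨fun hpr => ?_, fun hrp => ?_⟩
  · exact best_constant_equiv _ _ _ _ _ hc₂ hK0 hK (fun a => (hB1 hpr α β hα0 hβ0).1 a)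
      (hB1 hpr α β hα0 hβ0).2
  · exact best_constant_equiv _ _ _ _ _ hc₂ hK0 hK (fun a => (hB2 hrp α β hα0 hβ0).1 a)
      (hB2 hrp α β hα0 hβ0).2
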